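/- arXiv:math/0605326 — 3 statements merged into one kernel-verified Lean document; each statement's English description precedes it below -/
import Mathlib

section
/- Let R be a henselian local ring with maximal ideal m and residue field k = R/m, and let A be a smooth R-algebra (of finite presentation and formally smooth). Then every R-algebra homomorphism A → k lifts to an R-algebra homomorphism A → R; that is, for every φ : A →ₐ[R] k there exists ψ : A →ₐ[R] R such that composing ψ with the quotient map R → k gives φ. -/
universe u

open IsLocalRing in
/-- Lifting for standard étale algebras over a ring `M` mapping to the henselian ring `R`. -/
theorem standardEtale_lift_aux (R M B : Type*) [CommRing R] [HenselianLocalRing R]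
    [CommRing M] [Algebra M R] [CommRing B] [Algebra M B] (P : StandardEtalePresentation M B)
    (φ : B →ₐ[M] R ⧸ maximalIdeal R) :
    ∃ ψ : B →ₐ[M] R, (Ideal.Quotient.mkₐ M (maximalIdeal R)).comp ψ = φ := by
  have hm : P.P.HasMap (φ P.x) := P.hasMap.map φ
  obtain ⟨a₀, ha₀⟩ := Ideal.Quotient.mkₐ_surjective M (maximalIdeal R) (φ P.x)
  have key : ∀ (q : Polynomial M) (a : R), Polynomial.aeval (Ideal.Quotient.mkₐ M (maximalIdeal R) a) q
      = Ideal.Quotient.mk (maximalIdeal R) (Polynomial.aeval a q) := by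
    intro q a
    rw [Polynomial.aeval_algHom_apply]; rfl
  have unit_of : ∀ x : R, IsUnit (Ideal.Quotient.mk (maximalIdeal R) x) → IsUnit x := by
    intro x hx
    by_contra h
    have h0 : Ideal.Quotient.mk (maximalIdeal R) x = 0 :=
      Ideal.Quotient.eq_zero_iff_mem.2 ((mem_maximalIdeal x).2 h)
    rw [h0] at hx
    exact not_isUnit_zero hx
  obtain ⟨a, ha, haa⟩ := HenselianLocalRing.is_henselian (P.P.f.map (algebraMap M R))
    (P.P.monic_f.map _) a₀
    (by
      have h := hm.1
      rw [← ha₀, key] at h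
      rw [Polynomial.eval_map_algebraMap]
      exact Ideal.Quotient.eq_zero_iff_mem.1 h)
    (by
      have h := hm.isUnit_derivative_f
      rw [← ha₀, key] at h
      rw [Polynomial.derivative_map, Polynomial.eval_map_algebraMap]
      exact unit_of _ h)
  have hax : Ideal.Quotient.mkₐ M (maximalIdeal R) a = φ P.x := by
    rw [← ha₀]
    exact Ideal.Quotient.eq.2 haa
  have hma : P.P.HasMap a := by
    refine ⟨?_, unit_of _ ?_⟩
    · rwa [← Polynomial.eval_map_algebraMap]
    · rw [← key, hax]; exact hm.2
  refine ⟨(P.P.lift a hma).comp P.equivRing.toAlgHom, P.hom_ext ?_⟩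
  simpa using hax

/-- Let `R` be a henselian local ring with maximal ideal `m` and residue field `k = R/m`,
and let `A` be a smooth `R`-algebra (of finite presentation and formally smooth). Then every
`R`-algebra homomorphism `A → k` lifts to an `R`-algebra homomorphism `A → R`: for every
`φ : A →ₐ[R] k` there is `ψ : A →ₐ[R] R` whose composite with the quotient map `R → k` is `φ`. -/
theorem smooth_algebra_lift_of_henselianLocalRing
    (R : Type u) [CommRing R] [HenselianLocalRing R]
    (A : Type u) [CommRing A] [Algebra R A]
    [Algebra.FinitePresentation R A] [Algebra.FormallySmooth R A]
    (φ : A →ₐ[R] R ⧸ IsLocalRing.maximalIdeal R) :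
    ∃ ψ : A →ₐ[R] R,
      (Ideal.Quotient.mkₐ R (IsLocalRing.maximalIdeal R)).comp ψ = φ := by
  have hpr : (RingHom.ker φ).IsPrime := RingHom.ker_isPrime φ
  have hsm : Algebra.Smooth R A := ⟨inferInstance, inferInstance⟩
  have hat : Algebra.IsSmoothAt R (RingHom.ker φ) := by
    have h : (⟨RingHom.ker φ, hpr⟩ : PrimeSpectrum A) ∈ Algebra.smoothLocus R A := by
      rw [Algebra.smoothLocus_eq_univ]; trivial
    exact h
  obtain ⟨f, hf, n, _, _, ⟨⟨P⟩⟩⟩ :=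
    Algebra.IsSmoothAt.exists_isStandardEtale_mvPolynomial (R := R) (p := RingHom.ker φ)
  let : Field (R ⧸ IsLocalRing.maximalIdeal R) := Ideal.Quotient.field _
  have hu : IsUnit (φ f) := IsUnit.mk0 _ hf
  let φ' : Localization.Away f →ₐ[R] R ⧸ IsLocalRing.maximalIdeal R :=
    IsLocalization.Away.liftAlgHom (R := A) (A := R) (f := φ) f hu
  have hφ' : ∀ x, φ' (algebraMap A _ x) = φ x := fun x ↦ IsLocalization.Away.lift_eq f hu x
  choose r hr using fun i : Fin n ↦ Ideal.Quotient.mkₐ_surjective R (IsLocalRing.maximalIdeal R)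
    (φ' (algebraMap (MvPolynomial (Fin n) R) _ (MvPolynomial.X i)))
  let e : MvPolynomial (Fin n) R →ₐ[R] R := MvPolynomial.aeval r
  have he : (Ideal.Quotient.mkₐ R (IsLocalRing.maximalIdeal R)).comp e =
      φ'.comp (IsScalarTower.toAlgHom R (MvPolynomial (Fin n) R) (Localization.Away f)) := by
    apply MvPolynomial.algHom_ext
    intro i
    simpa [e] using hr i
  let : Algebra (MvPolynomial (Fin n) R) R := e.toRingHom.toAlgebra
  let φ'' : Localization.Away f →ₐ[MvPolynomial (Fin n) R] R ⧸ IsLocalRing.maximalIdeal R :=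
    { φ'.toRingHom with commutes' := fun x ↦ (DFunLike.congr_fun he x).symm }
  obtain ⟨ψ, hψ⟩ := standardEtale_lift_aux R _ _ P φ''
  let ψ' : Localization.Away f →ₐ[R] R :=
    { ψ.toRingHom with
      commutes' := fun x ↦ by
        rw [IsScalarTower.algebraMap_apply R (MvPolynomial (Fin n) R) (Localization.Away f)]
        exact (ψ.commutes _).trans (e.commutes x) }
  refine ⟨ψ'.comp (IsScalarTower.toAlgHom R A (Localization.Away f)), ?_⟩
  ext x
  exact (DFunLike.congr_fun hψ (algebraMap A _ x)).trans (hφ' x)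
end

section
/- Let A be a commutative ℤ-algebra that is finite étale over ℤ (finitely generated as a ℤ-module, flat, and formally unramified — equivalently formally étale) and suppose A is an integral domain. Then the structure map ℤ → A is an isomorphism of rings. -/
universe u

/-- Let `A` be a commutative `ℤ`-algebra that is finite étale over `ℤ` (finitely generated as a
`ℤ`-module, flat, and formally unramified) and an integral domain.  Then the structure map
`ℤ → A` is an isomorphism: the only connected finite étale `ℤ`-algebra is `ℤ` itself
(Minkowski: `Spec ℚ` is the only point over `ℚ` with good reduction everywhere). -/
theorem finite_etale_domain_over_int_is_int
    (A : Type u) [CommRing A] [Algebra ℤ A] [IsDomain A]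
    [Module.Finite ℤ A] [Module.Flat ℤ A] [Algebra.FormallyUnramified ℤ A] :
    Function.Bijective (algebraMap ℤ A) := by
  obtain rfl : ‹Algebra ℤ A› = Ring.toIntAlgebra A := Subsingleton.elim _ _
  have : FaithfulSMul ℤ A := inferInstance
  have : Algebra.Unramified ℤ A := { }
  exact bijective_algebraMap_int_of_finite_of_unramified
end

section
/- There is no Weierstrass curve over ℤ whose discriminant is a unit: for every Weierstrass equation y² + a₁xy + a₃y = x³ + a₂x² + a₄x + a₆ with coefficients a₁, a₂, a₃, a₄, a₆ ∈ ℤ, the discriminant Δ is not a unit of ℤ (i.e. Δ ∉ {1, −1}). -/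
lemma tate_three_dvd {y n : ℤ} (h : y ^ 2 = 3 * n) : ∃ z, y = 3 * z :=
  Int.prime_three.dvd_of_dvd_pow (Dvd.intro n h.symm)

lemma tate_odd_sq (u : ℤ) (h : u ^ 2 % 2 = 1) : u ^ 2 % 8 = 1 := by
  have h8 : u % 8 = 0 ∨ u % 8 = 1 ∨ u % 8 = 2 ∨ u % 8 = 3 ∨ u % 8 = 4 ∨ u % 8 = 5 ∨
    u % 8 = 6 ∨ u % 8 = 7 := by omega
  have h2 : u ^ 2 % 8 = (u % 8) ^ 2 % 8 := by rw [Int.emod_emod_of_dvd _ (dvd_refl _) |>.symm, pow_two, pow_two, Int.mul_emod]; simp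
  rcases h8 with h' | h' | h' | h' | h' | h' | h' | h' <;> rw [h'] at h2 <;> omega

lemma tate_key (e a y : ℤ) (ha : a % 8 = 5)
    (h : a * (a ^ 2 + 36 * e * a + 432) = y ^ 2) : (e = 1 ∨ e = -1) → False := by
  intro he
  by_cases h3 : (3 : ℤ) ∣ a
  · obtain ⟨b, rfl⟩ := h3
    obtain ⟨z, rfl⟩ := tate_three_dvd (y := y)
      (n := b * ((3 * b) ^ 2 + 36 * e * (3 * b) + 432)) (by linear_combination -h)
    have h1 : z ^ 2 = 3 * (b * (b ^ 2 + 12 * e * b + 48)) := by linarith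
    obtain ⟨w, rfl⟩ := tate_three_dvd h1
    have h2 : b * (b ^ 2 + 12 * e * b + 48) = 3 * w ^ 2 := by linarith
    obtain ⟨c, rfl⟩ : (3 : ℤ) ∣ b := Int.prime_three.dvd_of_dvd_pow (n := 3)
      ⟨w ^ 2 - 4 * e * b ^ 2 - 16 * b, by linear_combination h2⟩
    have h4 : w ^ 2 = 3 * (c * (3 * c ^ 2 + 12 * e * c + 16)) := by linarith
    obtain ⟨v, rfl⟩ := tate_three_dvd h4
    have h5 : c * (3 * c ^ 2 + 12 * e * c + 16) = 3 * v ^ 2 := by linarith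
    obtain ⟨t, rfl⟩ : (3 : ℤ) ∣ c :=
      ⟨v ^ 2 - c ^ 3 - 4 * e * c ^ 2 - 5 * c, by linear_combination h5⟩
    have h6 : t * (27 * t ^ 2 + 36 * e * t + 16) = v ^ 2 := by linarith
    have hpos : 0 < 27 * t ^ 2 + 36 * e * t + 16 := by
      rcases he with rfl | rfl
      · nlinarith [sq_nonneg (3 * t + 2)]
      · nlinarith [sq_nonneg (3 * t - 2)]
    have ht : 0 ≤ t := by
      by_contra hn
      push Not at hn
      nlinarith [sq_nonneg v, mul_pos (neg_pos.mpr hn) hpos]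
    have hc2 : IsCoprime t 2 := by
      refine ⟨1, -(t / 2), ?_⟩
      omega
    have hc : IsCoprime t (27 * t ^ 2 + 36 * e * t + 16) := by
      have := (hc2.pow_right (n := 4)).add_mul_left_right (27 * t + 36 * e)
      ring_nf at this ⊢; exact this
    obtain ⟨u, hu⟩ := Int.sq_of_isCoprime hc h6
    rcases hu with hu | hu
    · have := tate_odd_sq u (by omega)
      omega
    · have := sq_nonneg u
      omega
  · have hc3 : IsCoprime a 3 := ((Int.prime_three.coprime_iff_not_dvd).2 h3).symm
    have hc2 : IsCoprime a 2 := ⟨1, -(a / 2), by omega⟩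
    have hc : IsCoprime a (a ^ 2 + 36 * e * a + 432) := by
      have := ((hc2.pow_right (n := 4)).mul_right (hc3.pow_right (n := 3))).add_mul_left_right
        (a + 36 * e)
      ring_nf at this ⊢; exact this
    obtain ⟨u, hu⟩ := Int.sq_of_isCoprime hc h
    have := tate_odd_sq u (by omega)
    omega

/-- **Tate's theorem (integral model form).** There is no Weierstrass curve over `ℤ`
whose discriminant is a unit: for every Weierstrass equation
`y² + a₁xy + a₃y = x³ + a₂x² + a₄x + a₆` with integer coefficients, the discriminant `Δ`
is not a unit of `ℤ`. -/
theorem no_weierstrass_curve_over_int_with_unit_discriminant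
    (W : WeierstrassCurve ℤ) : ¬ IsUnit W.Δ := by
  intro hU
  have he := Int.isUnit_iff.1 hU
  have hrel := W.c_relation
  have hodd : W.a₁ % 2 = 1 := by
    by_contra hn
    obtain ⟨k, hk⟩ : ∃ k, W.a₁ = 2 * k := ⟨W.a₁ / 2, by omega⟩
    obtain ⟨m, hm⟩ : ∃ m, W.Δ = 8 * m - 27 * W.b₆ ^ 2 := by
      refine ⟨-2 * (k ^ 2 + W.a₂) ^ 2 * W.b₈ - W.b₄ ^ 3
        + 9 * (k ^ 2 + W.a₂) * (W.a₄ + k * W.a₃) * W.b₆, ?_⟩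
      have e2 : W.b₂ = 4 * (k ^ 2 + W.a₂) := by rw [WeierstrassCurve.b₂, hk]; ring
      have e4 : W.b₄ = 2 * (W.a₄ + k * W.a₃) := by rw [WeierstrassCurve.b₄, hk]; ring
      rw [WeierstrassCurve.Δ, e2, e4]; ring
    have := tate_odd_sq W.b₆ (by omega)
    omega
  have h1 : W.a₁ ^ 2 % 8 = 1 := tate_odd_sq _ (by
    rw [← Int.odd_iff] at hodd ⊢; exact hodd.pow)
  have hb : W.b₂ ^ 2 % 8 = 1 := tate_odd_sq _ (by
    rw [← Int.odd_iff]; apply Odd.pow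
    rw [Int.odd_iff, WeierstrassCurve.b₂]; omega)
  have hc4 : W.c₄ % 8 = 1 := by
    rw [WeierstrassCurve.c₄]; omega
  have he2 : W.Δ ^ 2 = 1 := by rcases he with h | h <;> rw [h] <;> norm_num
  refine tate_key W.Δ (W.c₄ - 12 * W.Δ) W.c₆ (by omega) ?_ he
  have he3 : W.Δ ^ 3 = W.Δ := by rw [pow_succ, he2, one_mul]
  linear_combination -hrel - 432 * W.c₄ * he2 + 3456 * he3
end
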